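/- arXiv:2212.01625 — 6 statements merged into one kernel-verified Lean document; each statement's English description precedes it below -/
import Mathlib

section
/- Let n be a positive integer, a ∈ ℝⁿ, and b, c ∈ ℝ with c < b, and suppose c ≤ a⋅x for every x ∈ {0,1}ⁿ. Let K be a positive integer. Then for every x ∈ {0,1}ⁿ the following are equivalent: (1) a⋅x ≤ b; (2) there exists an integer ẑ ∈ {0, 1, …, 2^K − 1} such that ((2^K − 1/2)/(b − c) · (a⋅x − c) − ẑ)² ≤ 1/4. -/
/-- Theorem 1 of the paper: for `x` in the Boolean hypercube, `a ⬝ x ≤ b` iff there is an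
integer slack value `ẑ ∈ {0, …, 2^K − 1}` making the approximate penalty at most `1/4`. -/
theorem approx_penalty_iff (n : ℕ) (hn : 0 < n) (a : Fin n → ℝ) (b c : ℝ) (hcb : c < b)
    (hlb : ∀ x : Fin n → ℝ, (∀ i, x i = 0 ∨ x i = 1) → c ≤ ∑ i, a i * x i)
    (K : ℕ) (hK : 0 < K) (x : Fin n → ℝ) (hx : ∀ i, x i = 0 ∨ x i = 1) :
    (∑ i, a i * x i ≤ b) ↔
      ∃ z : ℤ, 0 ≤ z ∧ z ≤ 2 ^ K - 1 ∧
        ((2 ^ K - 1 / 2) / (b - c) * ((∑ i, a i * x i) - c) - (z : ℝ)) ^ 2 ≤ 1 / 4 := by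
  have hs := hlb x hx
  generalize (∑ i, a i * x i) = s at hs ⊢
  have hd : 0 < b - c := sub_pos.mpr hcb
  have hM : (1 : ℝ) ≤ 2 ^ K := one_le_pow₀ (by norm_num)
  have hA : (0 : ℝ) < (2 ^ K - 1 / 2) / (b - c) := div_pos (by linarith) hd
  have hAd : ((2 : ℝ) ^ K - 1 / 2) / (b - c) * (b - c) = 2 ^ K - 1 / 2 :=
    div_mul_cancel₀ _ hd.ne'
  generalize ((2 : ℝ) ^ K - 1 / 2) / (b - c) = A at hA hAd ⊢
  constructor
  · intro h
    have h0 : 0 ≤ A * (s - c) := mul_nonneg hA.le (by linarith)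
    have h1 : A * (s - c) ≤ 2 ^ K - 1 / 2 := by
      rw [← hAd]
      exact mul_le_mul_of_nonneg_left (by linarith) hA.le
    generalize A * (s - c) = t at h0 h1 ⊢
    refine ⟨⌈t - 1 / 2⌉, ?_, ?_, ?_⟩
    · have : -1 < ⌈t - 1 / 2⌉ := by
        rw [Int.lt_ceil]
        push_cast
        linarith
      omega
    · rw [Int.ceil_le]
      push_cast
      linarith
    · have h2 := Int.le_ceil (t - 1 / 2)
      have h3 := Int.ceil_lt_add_one (t - 1 / 2)
      nlinarith
  · rintro ⟨z, -, hz, h⟩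
    have hz' : (z : ℝ) ≤ 2 ^ K - 1 := by exact_mod_cast hz
    have h1 : A * (s - c) - z ≤ 1 / 2 := by nlinarith
    have h2 : A * (s - c) ≤ A * (b - c) := by linarith
    have := le_of_mul_le_mul_left h2 hA
    linarith
end

section
/- Let b, c ∈ ℝ with c < b, let K be a positive integer, and set α_K = (2^K − 1/2)/(b − c). For every real number s with s > b and every integer ẑ ∈ {0, 1, …, 2^K − 1}, one has (α_K(s − c) − ẑ)² > 1/4. -/
/-- Values violating the constraint `s ≤ b` always receive a penalty strictly larger than `1/4`. -/
theorem penalty_gt_of_violation (b c : ℝ) (hcb : c < b) (K : ℕ) (hK : 0 < K)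
    (s : ℝ) (hs : s > b) (z : ℤ) (hz0 : 0 ≤ z) (hz1 : z ≤ 2 ^ K - 1) :
    ((2 ^ K - 1 / 2) / (b - c) * (s - c) - (z : ℝ)) ^ 2 > 1 / 4 := by
  have hz : (z : ℝ) ≤ 2 ^ K - 1 := by exact_mod_cast hz1
  have hp : (1 : ℝ) ≤ 2 ^ K := one_le_pow₀ (by norm_num)
  have hbc : 0 < b - c := sub_pos.mpr hcb
  have h : (2 ^ K - 1 / 2 : ℝ) < (2 ^ K - 1 / 2) / (b - c) * (s - c) := by
    rw [div_mul_eq_mul_div, lt_div_iff₀ hbc]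
    exact mul_lt_mul_of_pos_left (by linarith) (by linarith)
  nlinarith
end

section
/- Let n be a positive integer, a ∈ ℝⁿ, and b, c ∈ ℝ with c < b, and suppose c ≤ a⋅x for every x ∈ {0,1}ⁿ. Let K be a positive integer and set α_K = (2^K − 1/2)/(b − c). Then for every x ∈ {0,1}ⁿ: if a⋅x ≤ b, then the minimum over ẑ ∈ {0, 1, …, 2^K − 1} of (α_K(a⋅x − c) − ẑ)² is at most 1/4; and if a⋅x > b, then this minimum is strictly greater than 1/4. -/
/-- The minimum penalty over `ẑ ∈ {0, …, 2^K − 1}` is at most `1/4` when the constraint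
`a ⬝ x ≤ b` holds, and strictly larger than `1/4` when it is violated. -/
theorem min_penalty_dichotomy (n : ℕ) (hn : 0 < n) (a : Fin n → ℝ) (b c : ℝ) (hcb : c < b)
    (hlb : ∀ x : Fin n → ℝ, (∀ i, x i = 0 ∨ x i = 1) → c ≤ ∑ i, a i * x i)
    (K : ℕ) (hK : 0 < K) (x : Fin n → ℝ) (hx : ∀ i, x i = 0 ∨ x i = 1) :
    ((∑ i, a i * x i ≤ b) →
      (Finset.range (2 ^ K)).inf'
        (Finset.nonempty_range_iff.mpr (pow_ne_zero K two_ne_zero))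
        (fun z => ((2 ^ K - 1 / 2) / (b - c) * ((∑ i, a i * x i) - c) - (z : ℝ)) ^ 2)
        ≤ 1 / 4) ∧
    ((∑ i, a i * x i > b) →
      (Finset.range (2 ^ K)).inf'
        (Finset.nonempty_range_iff.mpr (pow_ne_zero K two_ne_zero))
        (fun z => ((2 ^ K - 1 / 2) / (b - c) * ((∑ i, a i * x i) - c) - (z : ℝ)) ^ 2)
        > 1 / 4) := by
  have hc := hlb x hx
  generalize (∑ i, a i * x i) = s at hc ⊢
  have hbc : 0 < b - c := sub_pos.mpr hcb
  have hN : (1 : ℝ) ≤ 2 ^ K := one_le_pow₀ (by norm_num)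
  have hα : 0 < ((2 : ℝ) ^ K - 1 / 2) / (b - c) := div_pos (by linarith) hbc
  have hαb : ((2 : ℝ) ^ K - 1 / 2) / (b - c) * (b - c) = 2 ^ K - 1 / 2 :=
    div_mul_cancel₀ _ hbc.ne'
  generalize ((2 : ℝ) ^ K - 1 / 2) / (b - c) = α at hα hαb ⊢
  constructor
  · intro hs
    have h0 : 0 ≤ α * (s - c) := mul_nonneg hα.le (by linarith)
    have h1 : α * (s - c) ≤ 2 ^ K - 1 / 2 := by
      rw [← hαb]
      exact mul_le_mul_of_nonneg_left (by linarith) hα.le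
    generalize α * (s - c) = t at h0 h1 ⊢
    rw [Finset.inf'_le_iff]
    have hf1 : ((⌊t + 1 / 2⌋₊ : ℕ) : ℝ) ≤ t + 1 / 2 := Nat.floor_le (by linarith)
    have hf2 : t + 1 / 2 < (⌊t + 1 / 2⌋₊ : ℕ) + 1 := Nat.lt_floor_add_one _
    by_cases h : ⌊t + 1 / 2⌋₊ < 2 ^ K
    · exact ⟨_, Finset.mem_range.mpr h, by nlinarith⟩
    · have h2 : (2 : ℝ) ^ K ≤ (⌊t + 1 / 2⌋₊ : ℕ) := by exact_mod_cast not_lt.mp h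
      have hp : 1 ≤ 2 ^ K := Nat.one_le_two_pow
      refine ⟨2 ^ K - 1, Finset.mem_range.mpr (by omega), ?_⟩
      have ht : t = 2 ^ K - 1 / 2 := by linarith
      push_cast [Nat.cast_sub hp]
      rw [ht]
      ring_nf
      norm_num
  · intro hs
    have h1 : 2 ^ K - 1 / 2 < α * (s - c) := by
      rw [← hαb]
      exact mul_lt_mul_of_pos_left (by linarith) hα
    generalize α * (s - c) = t at h1 ⊢
    rw [gt_iff_lt, Finset.lt_inf'_iff]
    intro z hz
    have hz' : (z : ℝ) + 1 ≤ 2 ^ K := by exact_mod_cast Finset.mem_range.mp hz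
    have : 1 / 2 < t - z := by linarith
    nlinarith
end

section
/- Let b, c ∈ ℝ with c < b, let K be a positive integer, and let α > 0 satisfy α(b − c) ≤ 2^K − 3/2. Set s = b + 1/α. Then s > b, yet there exists an integer ẑ ∈ {0, 1, …, 2^K − 1} such that (α(s − c) − ẑ)² ≤ 1/4. Hence a value violating the constraint s ≤ b receives a penalty at most 1/4. -/
/-- Case (ii): if `α > 0` is too small, the value `s = b + 1/α`, which violates the
constraint `s ≤ b`, nevertheless receives a penalty at most `1/4` for some slack `ẑ`. -/
theorem penalty_too_small_multiplier (b c : ℝ) (hcb : c < b) (K : ℕ) (hK : 0 < K)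
    (α : ℝ) (hα : 0 < α) (hαbc : α * (b - c) ≤ 2 ^ K - 3 / 2) :
    b + 1 / α > b ∧
      ∃ z : ℤ, 0 ≤ z ∧ z ≤ 2 ^ K - 1 ∧
        (α * (b + 1 / α - c) - (z : ℝ)) ^ 2 ≤ 1 / 4 := by
  have h0 : 0 < α * (b - c) := mul_pos hα (sub_pos.mpr hcb)
  have hx : α * (b + 1 / α - c) = α * (b - c) + 1 := by
    field_simp
    ring
  have h1 : 0 < 1 / α := by positivity
  refine ⟨by linarith, ⌈α * (b - c) + 1 / 2⌉, ?_, ?_, ?_⟩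
  · exact Int.ceil_nonneg (by linarith)
  · rw [Int.ceil_le]
    push_cast
    linarith
  · rw [hx]
    have h2 := Int.le_ceil (α * (b - c) + 1 / 2)
    have h3 := Int.ceil_lt_add_one (α * (b - c) + 1 / 2)
    nlinarith
end

section
/- Let b, c ∈ ℝ with c < b, let K be a positive integer, and set α_K = (2^K − 1/2)/(b − c). For every real number s with s > b, writing ε = s − b > 0, the minimum over integers ẑ ∈ {0, 1, …, 2^K − 1} of (α_K(s − c) − ẑ)² equals 1/4 + α_K ε + (α_K ε)², and this minimum is attained at ẑ = 2^K − 1. -/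
/-- Proposition on the size of the penalty: for `s > b` with violation `ε = s − b`, the minimum
penalty over `ẑ ∈ {0, …, 2^K − 1}` equals `1/4 + α_K ε + (α_K ε)²` and is attained at
`ẑ = 2^K − 1`. -/
theorem penalty_violation_size (b c : ℝ) (hcb : c < b) (K : ℕ) (hK : 0 < K)
    (s : ℝ) (hs : s > b) :
    IsLeast {p : ℝ | ∃ z : ℤ, 0 ≤ z ∧ z ≤ 2 ^ K - 1 ∧
        p = ((2 ^ K - 1 / 2) / (b - c) * (s - c) - (z : ℝ)) ^ 2}
      (1 / 4 + (2 ^ K - 1 / 2) / (b - c) * (s - b) +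
        ((2 ^ K - 1 / 2) / (b - c) * (s - b)) ^ 2) ∧
    ((2 ^ K - 1 / 2) / (b - c) * (s - c) - (((2 ^ K - 1 : ℤ)) : ℝ)) ^ 2 =
      1 / 4 + (2 ^ K - 1 / 2) / (b - c) * (s - b) +
        ((2 ^ K - 1 / 2) / (b - c) * (s - b)) ^ 2 := by
  have hbc : 0 < b - c := sub_pos.2 hcb
  have h1 : (1 : ℝ) ≤ 2 ^ K := one_le_pow₀ (by norm_num)
  have h1z : (1 : ℤ) ≤ 2 ^ K := one_le_pow₀ (by norm_num)
  have key : ((2 : ℝ) ^ K - 1 / 2) / (b - c) * (s - c) =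
      (2 ^ K - 1 / 2) / (b - c) * (s - b) + (2 ^ K - 1 / 2) := by
    field_simp
    ring
  have hpos : 0 < ((2 : ℝ) ^ K - 1 / 2) / (b - c) * (s - b) :=
    mul_pos (div_pos (by linarith) hbc) (sub_pos.2 hs)
  rw [key]
  generalize ((2 : ℝ) ^ K - 1 / 2) / (b - c) * (s - b) = t at hpos ⊢
  have heq : (t + ((2 : ℝ) ^ K - 1 / 2) - (((2 ^ K - 1 : ℤ)) : ℝ)) ^ 2 = 1 / 4 + t + t ^ 2 := by
    push_cast
    ring
  refine ⟨⟨⟨2 ^ K - 1, by linarith, le_refl _, heq.symm⟩, ?_⟩, heq⟩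
  rintro p ⟨z, _, hz, rfl⟩
  have hz' : (z : ℝ) ≤ 2 ^ K - 1 := by exact_mod_cast hz
  have h2 : t + 1 / 2 ≤ t + ((2 : ℝ) ^ K - 1 / 2) - z := by linarith
  have h3 := pow_le_pow_left₀ (by linarith : 0 ≤ t + 1 / 2) h2 2
  linarith [h3, (by ring : (t + 1 / 2) ^ 2 = 1 / 4 + t + t ^ 2)]
end

section
/- Let b, c ∈ ℤ with 0 ≤ b − c ≤ 2^{I−1} − 1 for a positive integer I, and set s = b + 1/2, so that s > b. Then, with P_int(s, z) = (s − c − Σ_{i=0}^{I−2} 2^i z_i − z_{I−1}(2^I − 1 − b + c))², there exists z ∈ {0,1}^I with P_int(s, z) = 1/4. Hence a value strictly violating the constraint s ≤ b attains the same minimal penalty 1/4 as half-integer values satisfying the constraint. -/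
/-- Binary expansion with real 0/1 digits vanishing from position `n` on. -/
theorem exists_binary_digits (n : ℕ) : ∀ m : ℕ, m < 2 ^ n →
    ∃ z : ℕ → ℝ, (∀ i, z i = 0 ∨ z i = 1) ∧ (∀ i, n ≤ i → z i = 0) ∧
      ∑ i ∈ Finset.range n, 2 ^ i * z i = (m : ℝ) := by
  induction n with
  | zero =>
    intro m hm
    have hm0 : m = 0 := by simpa using hm
    exact ⟨fun _ => 0, fun _ => Or.inl rfl, fun _ _ => rfl, by simp [hm0]⟩
  | succ n ih =>
    intro m hm
    obtain ⟨z, hz, hz0, hs⟩ := ih (m / 2) (by rw [pow_succ] at hm; omega)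
    refine ⟨fun i => Nat.casesOn i ((m % 2 : ℕ) : ℝ) z, ?_, ?_, ?_⟩
    · rintro (_ | i)
      · rcases Nat.mod_two_eq_zero_or_one m with h | h <;> simp [h]
      · exact hz i
    · rintro (_ | i) hi
      · omega
      · exact hz0 i (by omega)
    · rw [Finset.sum_range_succ']
      have h2 : ∑ i ∈ Finset.range n, (2 : ℝ) ^ (i + 1) * z i = 2 * ((m / 2 : ℕ) : ℝ) := by
        rw [← hs, Finset.mul_sum]
        exact Finset.sum_congr rfl fun i _ => by ring
      have h3 : (2 : ℝ) * ((m / 2 : ℕ) : ℝ) + ((m % 2 : ℕ) : ℝ) = m := by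
        exact_mod_cast Nat.div_add_mod m 2
      simpa [h2] using h3

/-- For integer data with `0 ≤ b − c ≤ 2^(I−1) − 1`, the value `s = b + 1/2` strictly
violates the constraint `s ≤ b` yet attains the minimal penalty `1/4` for some binary
slack vector `z ∈ {0,1}^I`. -/
theorem int_penalty_violation_quarter (b c : ℤ) (I : ℕ) (hI : 0 < I)
    (h0 : 0 ≤ b - c) (h1 : b - c ≤ 2 ^ (I - 1) - 1) :
    ((b : ℝ) + 1 / 2 > (b : ℝ)) ∧
      ∃ z : ℕ → ℝ, (∀ i, z i = 0 ∨ z i = 1) ∧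
        (((b : ℝ) + 1 / 2) - (c : ℝ) - (∑ i ∈ Finset.range (I - 1), 2 ^ i * z i)
            - z (I - 1) * ((2 : ℝ) ^ I - 1 - (b : ℝ) + (c : ℝ))) ^ 2 = 1 / 4 := by
  refine ⟨by linarith, ?_⟩
  obtain ⟨m, hm⟩ := Int.eq_ofNat_of_zero_le h0
  have hlt : m < 2 ^ (I - 1) := by
    have h : (m : ℤ) < 2 ^ (I - 1) := by omega
    exact_mod_cast h
  obtain ⟨z, hz, hz0, hs⟩ := exists_binary_digits (I - 1) m hlt
  refine ⟨z, hz, ?_⟩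
  have hr : (b : ℝ) - c = m := by exact_mod_cast hm
  rw [hs, hz0 (I - 1) le_rfl, ← hr]
  ring
end
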